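/- Let H be the Hamiltonian of form (4), K = S₃, and fix a > 0, g ∈ ℝ. Then the set Σ = {(H(y), S₃(y)) : y ∈ M⁴_{a,g}, sgrad H(y) and sgrad K(y) linearly dependent} ⊂ ℝ² equals the union of: (1) the two points Z_± = ( g²/(2βa) + g·g₂(a,±√a) ± (g/√a)·g₃(a,±√a) + V(a,±√a), ±g/√a ), and (2) the set {(W_{a,g}(k,x), k) : k ∈ ℝ, x² < a, ∂W_{a,g}/∂x(k,x) = 0}. -/

import Mathlib

noncomputable section

/-- ℝ⁶ with coordinates (S₁,S₂,S₃,R₁,R₂,R₃). -/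
abbrev E6 := Fin 6 → ℝ

/-- Partial derivative of `f` at `y` in the `i`-th coordinate direction. -/
def pd (f : E6 → ℝ) (y : E6) (i : Fin 6) : ℝ := fderiv ℝ f y (Pi.single i 1)

/-- Cross product in ℝ³. -/
def cross (u v : Fin 3 → ℝ) : Fin 3 → ℝ :=
  ![u 1 * v 2 - u 2 * v 1, u 2 * v 0 - u 0 * v 2, u 0 * v 1 - u 1 * v 0]

/-- Euclidean inner product in ℝ³. -/
def dot (u v : Fin 3 → ℝ) : ℝ := u 0 * v 0 + u 1 * v 1 + u 2 * v 2

/-- Assemble a point of ℝ⁶ from S- and R-blocks. -/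
def pt (S R : Fin 3 → ℝ) : E6 := ![S 0, S 1, S 2, R 0, R 1, R 2]

/-- S-block of a point of ℝ⁶. -/
def Sv (y : E6) : Fin 3 → ℝ := ![y 0, y 1, y 2]

/-- R-block of a point of ℝ⁶. -/
def Rv (y : E6) : Fin 3 → ℝ := ![y 3, y 4, y 5]

/-- The Hamiltonian vector field (skew gradient)
`sgrad f = (∂f/∂S × S + ∂f/∂R × R, ∂f/∂S × R)`. -/
def sgrad (f : E6 → ℝ) (y : E6) : E6 :=
  pt (cross ![pd f y 0, pd f y 1, pd f y 2] (Sv y)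
        + cross ![pd f y 3, pd f y 4, pd f y 5] (Rv y))
     (cross ![pd f y 0, pd f y 1, pd f y 2] (Rv y))

/-- The Lie–Poisson bracket for e(3)*:
`{f,g}(S,R) = ⟨S, f_S × g_S⟩ + ⟨R, f_S × g_R⟩ + ⟨R, f_R × g_S⟩`. -/
def bracket (f g : E6 → ℝ) (y : E6) : ℝ :=
  dot (Sv y) (cross ![pd f y 0, pd f y 1, pd f y 2] ![pd g y 0, pd g y 1, pd g y 2])
  + dot (Rv y) (cross ![pd f y 0, pd f y 1, pd f y 2] ![pd g y 3, pd g y 4, pd g y 5])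
  + dot (Rv y) (cross ![pd f y 3, pd f y 4, pd f y 5] ![pd g y 0, pd g y 1, pd g y 2])

/-- The Hamiltonian of form (4). -/
def H4 (β : ℝ) (g₁ g₂ g₃ V : ℝ → ℝ → ℝ) (y : E6) : ℝ :=
  (1/2) * ((y 0)^2 + (y 1)^2 + (y 2)^2 / β)
  + g₁ ((y 3)^2 + (y 4)^2 + (y 5)^2) (y 5) * (y 0 * y 4 - y 1 * y 3)
  + g₂ ((y 3)^2 + (y 4)^2 + (y 5)^2) (y 5) * (y 0 * y 3 + y 1 * y 4 + y 2 * y 5)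
  + g₃ ((y 3)^2 + (y 4)^2 + (y 5)^2) (y 5) * y 2
  + V ((y 3)^2 + (y 4)^2 + (y 5)^2) (y 5)

/-- The reduced potential `W_{a,g}(k,x)`. -/
def W (β : ℝ) (g₁ g₂ g₃ V : ℝ → ℝ → ℝ) (a g k x : ℝ) : ℝ :=
  (g - k*x)^2 / (2*(a - x^2)) + k^2/(2*β) - (g₁ a x)^2 * (a - x^2)/2
  + g₂ a x * g + g₃ a x * k + V a x


/-- Projection to the `i`-th coordinate. -/
def prj (i : Fin 6) : E6 →L[ℝ] ℝ := ContinuousLinearMap.proj i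

lemma hasF_prj (i : Fin 6) (y : E6) : HasFDerivAt (fun z : E6 => z i) (prj i) y :=
  (prj i).hasFDerivAt

lemma hasF_comp (G : ℝ → ℝ → ℝ) (hG : ContDiff ℝ (⊤ : ℕ∞) (Function.uncurry G)) (y : E6) :
    ∃ p q : ℝ, HasDerivAt (fun t => G ((y 3)^2 + (y 4)^2 + (y 5)^2) t) q (y 5) ∧
      HasFDerivAt (fun z : E6 => G ((z 3)^2 + (z 4)^2 + (z 5)^2) (z 5))
        (p • ((2 * y 3) • prj 3 + (2 * y 4) • prj 4 + (2 * y 5) • prj 5) + q • prj 5) y := by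
  have hd : DifferentiableAt ℝ (Function.uncurry G) ((y 3)^2 + (y 4)^2 + (y 5)^2, y 5) :=
    (hG.differentiable (by simp)).differentiableAt
  have hL := hd.hasFDerivAt
  set L := fderiv ℝ (Function.uncurry G) ((y 3)^2 + (y 4)^2 + (y 5)^2, y 5) with hLdef
  refine ⟨L (1, 0), L (0, 1), ?_, ?_⟩
  · have h1 : HasDerivAt (fun t : ℝ => ((y 3)^2 + (y 4)^2 + (y 5)^2, t)) ((0 : ℝ), (1 : ℝ)) (y 5) :=
      (hasDerivAt_const _ _).prodMk (hasDerivAt_id _)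
    exact hL.comp_hasDerivAt (y 5) h1
  · have h1 : HasFDerivAt (fun z : E6 => ((z 3)^2 + (z 4)^2 + (z 5)^2, z 5))
        (((2 * y 3) • prj 3 + (2 * y 4) • prj 4 + (2 * y 5) • prj 5).prod (prj 5)) y := by
      refine HasFDerivAt.prodMk ?_ (hasF_prj 5 y)
      have := (((hasF_prj 3 y).pow 2).add ((hasF_prj 4 y).pow 2)).add ((hasF_prj 5 y).pow 2)
      refine HasFDerivAt.congr_fderiv (f := fun z : E6 => (z 3)^2 + (z 4)^2 + (z 5)^2) this ?_
      simp
    have h2 := hL.comp y h1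
    refine HasFDerivAt.congr_fderiv
      (f := fun z : E6 => G ((z 3)^2 + (z 4)^2 + (z 5)^2) (z 5)) h2 ?_
    refine ContinuousLinearMap.ext fun v => ?_
    simp only [add_apply, smul_apply,
      ContinuousLinearMap.comp_apply, ContinuousLinearMap.prod_apply, smul_eq_mul]
    generalize 2 * y 3 * prj 3 _ + 2 * y 4 * prj 4 _ + 2 * y 5 * prj 5 _ = u
    generalize prj 5 _ = w
    have : ((u, w) : ℝ × ℝ) = u • (1, 0) + w • (0, 1) := by simp
    rw [this, map_add, map_smul, map_smul]
    simp only [smul_eq_mul]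
    ring

lemma sgradK (y : E6) : sgrad (fun z => z 2) y = ![-y 1, y 0, 0, -y 4, y 3, 0] := by
  have h : ∀ i, pd (fun z : E6 => z 2) y i = if i = 2 then 1 else 0 := by
    intro i
    rw [pd, (hasF_prj 2 y).fderiv]
    simp [prj, Pi.single_apply, eq_comm]
  ext i
  fin_cases i <;> simp [sgrad, pt, cross, Sv, Rv, h]

lemma pdH (β : ℝ) (g₁ g₂ g₃ V : ℝ → ℝ → ℝ)
    (hg₁ : ContDiff ℝ (⊤ : ℕ∞) (Function.uncurry g₁))
    (hg₂ : ContDiff ℝ (⊤ : ℕ∞) (Function.uncurry g₂))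
    (hg₃ : ContDiff ℝ (⊤ : ℕ∞) (Function.uncurry g₃))
    (hV : ContDiff ℝ (⊤ : ℕ∞) (Function.uncurry V)) (y : E6) (a : ℝ)
    (hy : (y 3)^2 + (y 4)^2 + (y 5)^2 = a) :
    ∃ q₁ q₂ q₃ q₄ P : ℝ,
      HasDerivAt (fun t => g₁ a t) q₁ (y 5) ∧ HasDerivAt (fun t => g₂ a t) q₂ (y 5) ∧
      HasDerivAt (fun t => g₃ a t) q₃ (y 5) ∧ HasDerivAt (fun t => V a t) q₄ (y 5) ∧
      pd (H4 β g₁ g₂ g₃ V) y 0 = y 0 + g₁ a (y 5) * y 4 + g₂ a (y 5) * y 3 ∧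
      pd (H4 β g₁ g₂ g₃ V) y 1 = y 1 - g₁ a (y 5) * y 3 + g₂ a (y 5) * y 4 ∧
      pd (H4 β g₁ g₂ g₃ V) y 2 = y 2 / β + g₂ a (y 5) * y 5 + g₃ a (y 5) ∧
      pd (H4 β g₁ g₂ g₃ V) y 3 = P * y 3 - g₁ a (y 5) * y 1 + g₂ a (y 5) * y 0 ∧
      pd (H4 β g₁ g₂ g₃ V) y 4 = P * y 4 + g₁ a (y 5) * y 0 + g₂ a (y 5) * y 1 ∧
      pd (H4 β g₁ g₂ g₃ V) y 5 = P * y 5 + g₂ a (y 5) * y 2 +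
        (q₁ * (y 0 * y 4 - y 1 * y 3) + q₂ * (y 0 * y 3 + y 1 * y 4 + y 2 * y 5)
          + q₃ * y 2 + q₄) := by
  obtain ⟨p₁, q₁, d₁, f₁⟩ := hasF_comp g₁ hg₁ y
  obtain ⟨p₂, q₂, d₂, f₂⟩ := hasF_comp g₂ hg₂ y
  obtain ⟨p₃, q₃, d₃, f₃⟩ := hasF_comp g₃ hg₃ y
  obtain ⟨p₄, q₄, d₄, f₄⟩ := hasF_comp V hV y
  rw [hy] at d₁ d₂ d₃ d₄
  have e := fun i => hasF_prj i y
  have hH := ((((((((e 0).pow 2).add ((e 1).pow 2)).add (((e 2).pow 2).mul_const β⁻¹)).const_mul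
      (1/2)).add (f₁.mul (((e 0).mul (e 4)).sub ((e 1).mul (e 3))))).add
      (f₂.mul ((((e 0).mul (e 3)).add ((e 1).mul (e 4))).add ((e 2).mul (e 5))))).add
      (f₃.mul (e 2))).add f₄
  have hH' := HasFDerivAt.fderiv (f := H4 β g₁ g₂ g₃ V) hH
  refine ⟨q₁, q₂, q₃, q₄, 2 * (p₁ * (y 0 * y 4 - y 1 * y 3)
    + p₂ * (y 0 * y 3 + y 1 * y 4 + y 2 * y 5) + p₃ * y 2 + p₄), d₁, d₂, d₃, d₄, ?_⟩
  simp only [pd, hH']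
  refine ⟨?_, ?_, ?_, ?_, ?_, ?_⟩ <;>
  · simp [prj, Pi.single_apply, hy]
    try ring

lemma hasDeriv_W (β : ℝ) (g₁ g₂ g₃ V : ℝ → ℝ → ℝ) (a g k x q₁ q₂ q₃ q₄ ν : ℝ) (hx : x^2 < a)
    (h₁ : HasDerivAt (fun t => g₁ a t) q₁ x) (h₂ : HasDerivAt (fun t => g₂ a t) q₂ x)
    (h₃ : HasDerivAt (fun t => g₃ a t) q₃ x) (h₄ : HasDerivAt (fun t => V a t) q₄ x)
    (hν : g = k * x + ν * (a - x^2)) :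
    deriv (fun t => W β g₁ g₂ g₃ V a g k t) x =
      -(k * ν) + ν^2 * x - q₁ * g₁ a x * (a - x^2) + (g₁ a x)^2 * x + q₂ * g + q₃ * k + q₄ := by
  have hne : a - x^2 ≠ 0 := by linarith
  have i := hasDerivAt_id x
  have n := (((i.const_mul k).const_sub g).pow 2)
  have r := ((i.pow 2).const_sub a)
  have h := ((((((n.div (r.const_mul 2) (by simpa using hne)).add_const (k^2/(2*β))).sub
    (((h₁.pow 2).mul r).div_const 2)).add (h₂.mul_const g)).add (h₃.mul_const k)).add h₄)
  have h' := HasDerivAt.deriv (f := fun t => W β g₁ g₂ g₃ V a g k t) h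
  rw [h']
  have hgk : g - k * x = ν * (a - x^2) := by linarith
  simp [hgk]
  field_simp
  ring

lemma W_val (β : ℝ) (g₁ g₂ g₃ V : ℝ → ℝ → ℝ) (a g ν : ℝ) (y : E6)
    (hx : (y 5)^2 < a) (hy : (y 3)^2 + (y 4)^2 + (y 5)^2 = a)
    (hg : y 0 * y 3 + y 1 * y 4 + y 2 * y 5 = g)
    (h0 : y 0 = ν * y 3 - g₁ a (y 5) * y 4) (h1 : y 1 = ν * y 4 + g₁ a (y 5) * y 3) :
    H4 β g₁ g₂ g₃ V y = W β g₁ g₂ g₃ V a g (y 2) (y 5) := by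
  have hr : a - (y 5)^2 = (y 3)^2 + (y 4)^2 := by linarith
  have hr0 : (y 3)^2 + (y 4)^2 ≠ 0 := by linarith
  have hgk : g - y 2 * y 5 = ν * ((y 3)^2 + (y 4)^2) := by
    rw [← hg, h0, h1]; ring
  simp only [H4, W, hy, hg, hr, hgk]
  rw [h0, h1]
  field_simp
  ring

/-- the bifurcation diagram Σ on the plane ℝ²(h,k). -/
theorem statement11 (β : ℝ) (hβ : 0 < β) (g₁ g₂ g₃ V : ℝ → ℝ → ℝ)
    (hg₁ : ContDiff ℝ (⊤ : ℕ∞) (Function.uncurry g₁))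
    (hg₂ : ContDiff ℝ (⊤ : ℕ∞) (Function.uncurry g₂))
    (hg₃ : ContDiff ℝ (⊤ : ℕ∞) (Function.uncurry g₃))
    (hV : ContDiff ℝ (⊤ : ℕ∞) (Function.uncurry V))
    (a g : ℝ) (ha : 0 < a) :
    let H : E6 → ℝ := H4 β g₁ g₂ g₃ V
    let K : E6 → ℝ := fun z => z 2
    {p : ℝ × ℝ | ∃ y : E6,
        ((y 3)^2 + (y 4)^2 + (y 5)^2 = a ∧ y 0 * y 3 + y 1 * y 4 + y 2 * y 5 = g) ∧
        ¬ LinearIndependent ℝ ![sgrad H y, sgrad K y] ∧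
        p = (H y, y 2)}
    = ({(g^2/(2*β*a) + g * g₂ a (Real.sqrt a)
            + (g / Real.sqrt a) * g₃ a (Real.sqrt a) + V a (Real.sqrt a),
          g / Real.sqrt a),
        (g^2/(2*β*a) + g * g₂ a (-Real.sqrt a)
            - (g / Real.sqrt a) * g₃ a (-Real.sqrt a) + V a (-Real.sqrt a),
          -(g / Real.sqrt a))} : Set (ℝ × ℝ))
      ∪ {p : ℝ × ℝ | ∃ k x : ℝ, x^2 < a ∧
          deriv (fun t => W β g₁ g₂ g₃ V a g k t) x = 0 ∧
          p = (W β g₁ g₂ g₃ V a g k x, k)} := by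
  intro H K
  ext p
  simp only [Set.mem_ofPred_eq, Set.mem_union, Set.mem_insert_iff, Set.mem_singleton_iff]
  have hsa : Real.sqrt a ^ 2 = a := Real.sq_sqrt ha.le
  have hs0 : 0 < Real.sqrt a := Real.sqrt_pos.2 ha
  constructor
  · rintro ⟨y, ⟨hy, hg⟩, hdep, rfl⟩
    obtain ⟨q₁, q₂, q₃, q₄, P, d₁, d₂, d₃, d₄, e0, e1, e2, e3, e4, e5⟩ :=
      pdH β g₁ g₂ g₃ V hg₁ hg₂ hg₃ hV y a hy
    rw [LinearIndependent.pair_iff] at hdep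
    push Not at hdep
    obtain ⟨s, t, hst, hne⟩ := hdep
    rw [sgradK] at hst
    have c0 := congrFun hst 0
    have c1 := congrFun hst 1
    have c3 := congrFun hst 3
    have c4 := congrFun hst 4
    have c5 := congrFun hst 5
    simp [sgrad, pt, cross, Sv, Rv] at c0 c1 c3 c4 c5
    change pd H y 0 = _ at e0
    change pd H y 1 = _ at e1
    change pd H y 2 = _ at e2
    change pd H y 3 = _ at e3
    change pd H y 4 = _ at e4
    change pd H y 5 = _ at e5
    simp only [e0, e1, e2, e3, e4, e5] at c0 c1 c3 c4 c5
    by_cases hR : y 3 = 0 ∧ y 4 = 0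
    · obtain ⟨h3, h4⟩ := hR
      have hx2 : (y 5)^2 = a := by rw [← hy, h3, h4]; ring
      have h5 : y 5 ≠ 0 := by rintro h; rw [h] at hx2; simp at hx2; linarith
      have hS : y 0 = 0 ∧ y 1 = 0 := by
        by_cases hs : s = 0
        · have ht := hne hs
          simp [hs, ht] at c0 c1
          exact ⟨c1, c0⟩
        · simp [h3, h4, hs, h5] at c3 c4
          exact ⟨c4, c3⟩
      obtain ⟨h0, h1⟩ := hS
      have hk : y 2 * y 5 = g := by rw [← hg, h3, h4]; ring
      left
      have hval : H y = (y 2)^2 / (2 * β) + g * g₂ a (y 5) + y 2 * g₃ a (y 5) + V a (y 5) := by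
        simp only [H, H4, hy, hg]
        rw [h0, h1, h3, h4]
        field_simp
        ring
      have hk2 : (y 2)^2 / (2 * β) = g^2 / (2 * β * a) := by
        rw [← hk, ← hx2]; field_simp
      rcases sq_eq_sq_iff_eq_or_eq_neg.1 (hx2.trans hsa.symm) with h | h
      · left
        have : y 2 = g / Real.sqrt a := by rw [← hk, h]; field_simp
        rw [hval, hk2, h, this]
      · right
        have : y 2 = -(g / Real.sqrt a) := by rw [← hk, h]; field_simp
        rw [hval, hk2, h, this]
        ext
        · simp only []; ring
        · rfl
    · right
      have hr : 0 < (y 3)^2 + (y 4)^2 := by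
        rcases not_and_or.1 hR with h | h
        · have := sq_pos_of_ne_zero h; positivity
        · have := sq_pos_of_ne_zero h; positivity
      have hx : (y 5)^2 < a := by linarith
      have hs : s ≠ 0 := by
        intro hs
        have ht := hne hs
        simp [hs, ht] at c3 c4
        exact hR ⟨c4, c3⟩
      have c5' : y 0 * y 4 - y 1 * y 3 + g₁ a (y 5) * ((y 3)^2 + (y 4)^2) = 0 := by
        rcases c5 with h | h
        · exact absurd h hs
        · linear_combination h
      set r := (y 3)^2 + (y 4)^2 with hrdef
      obtain ⟨ν, hν⟩ : ∃ ν, y 0 * y 3 + y 1 * y 4 = ν * r :=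
        ⟨(y 0 * y 3 + y 1 * y 4) / r, by field_simp⟩
      have h0 : y 0 = ν * y 3 - g₁ a (y 5) * y 4 := by
        apply mul_right_cancel₀ hr.ne'
        rw [hrdef] at *
        linear_combination y 3 * hν + y 4 * c5'
      have h1 : y 1 = ν * y 4 + g₁ a (y 5) * y 3 := by
        apply mul_right_cancel₀ hr.ne'
        rw [hrdef] at *
        linear_combination y 4 * hν - y 3 * c5'
      have hra : a - (y 5)^2 = r := by linarith
      refine ⟨y 2, y 5, hx, ?_, ?_⟩
      · rw [hasDeriv_W β g₁ g₂ g₃ V a g (y 2) (y 5) q₁ q₂ q₃ q₄ ν hx d₁ d₂ d₃ d₄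
          (by rw [hra, ← hν]; linarith), hra]
        apply mul_left_cancel₀ hs
        apply mul_left_cancel₀ hr.ne'
        rw [← hg]
        rw [hrdef]
        clear_value r
        generalize g₁ a (y 5) = G₁ at *
        generalize g₂ a (y 5) = G₂ at *
        generalize g₃ a (y 5) = G₃ at *
        rw [h0, h1]
        simp only [h0, h1] at c0 c1 c3 c4
        have key : t * (y 3)^2 + t * (y 4)^2 + s * ((y 3)^2 + (y 4)^2) * (y 2 / β + G₃ - ν * y 5)= 0 := by
          linear_combination y 3 * c4 - y 4 * c3
        linear_combination y 3 * c1 - y 4 * c0 - ν * key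
      · rw [← W_val β g₁ g₂ g₃ V a g ν y hx hy hg h0 h1]
  · rintro ((h | h) | ⟨k, x, hx, hW, rfl⟩)
    · refine ⟨![0, 0, g / Real.sqrt a, 0, 0, Real.sqrt a], ⟨by simp [hsa], by simp; field_simp⟩, ?_, ?_⟩
      · intro hli
        apply hli.ne_zero 1
        simp only [K, Matrix.cons_val_one, Matrix.cons_val_zero, sgradK]
        ext i; fin_cases i <;> simp
      · rw [h]
        simp [H, H4, hsa]
        nth_rewrite 1 [← hsa]
        field_simp
    · refine ⟨![0, 0, -(g / Real.sqrt a), 0, 0, -Real.sqrt a], ⟨by simp [hsa], by simp; field_simp⟩, ?_, ?_⟩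
      · intro hli
        apply hli.ne_zero 1
        simp only [K, Matrix.cons_val_one, Matrix.cons_val_zero, sgradK]
        ext i; fin_cases i <;> simp
      · rw [h]
        simp [H, H4, hsa]
        nth_rewrite 1 [← hsa]
        field_simp
        ring
    · have hr : 0 < a - x^2 := by linarith
      obtain ⟨ν, hν⟩ : ∃ ν, g = k * x + ν * (a - x^2) :=
        ⟨(g - k * x) / (a - x^2), by field_simp; ring⟩
      obtain ⟨ρ, hρ0, hρ⟩ : ∃ ρ, 0 < ρ ∧ ρ^2 = a - x^2 :=
        ⟨Real.sqrt (a - x^2), Real.sqrt_pos.2 hr, Real.sq_sqrt hr.le⟩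
      obtain ⟨y, hydef⟩ : ∃ y : E6, y = ![ν * ρ, g₁ a x * ρ, k, ρ, 0, x] := ⟨_, rfl⟩
      have y0 : y 0 = ν * ρ := by rw [hydef]; rfl
      have y1 : y 1 = g₁ a x * ρ := by rw [hydef]; rfl
      have y2 : y 2 = k := by rw [hydef]; rfl
      have y3 : y 3 = ρ := by rw [hydef]; rfl
      have y4 : y 4 = 0 := by rw [hydef]; rfl
      have y5 : y 5 = x := by rw [hydef]; rfl
      clear hydef
      have hy : (y 3)^2 + (y 4)^2 + (y 5)^2 = a := by rw [y3, y4, y5, hρ]; ring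
      have hg : y 0 * y 3 + y 1 * y 4 + y 2 * y 5 = g := by
        rw [y0, y1, y2, y3, y4, y5, hν, ← hρ]; ring
      obtain ⟨q₁, q₂, q₃, q₄, P, d₁, d₂, d₃, d₄, e0, e1, e2, e3, e4, e5⟩ :=
        pdH β g₁ g₂ g₃ V hg₁ hg₂ hg₃ hV y a hy
      refine ⟨y, ⟨hy, hg⟩, ?_, ?_⟩
      · rw [y5] at d₁ d₂ d₃ d₄
        rw [hasDeriv_W β g₁ g₂ g₃ V a g k x q₁ q₂ q₃ q₄ ν hx d₁ d₂ d₃ d₄ hν] at hW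
        rw [hg] at e5
        change pd H y 0 = _ at e0
        change pd H y 1 = _ at e1
        change pd H y 2 = _ at e2
        change pd H y 3 = _ at e3
        change pd H y 4 = _ at e4
        change pd H y 5 = _ at e5
        simp only [y0, y1, y2, y3, y4, y5] at e0 e1 e2 e3 e4 e5
        rw [← hρ] at hW
        rw [LinearIndependent.pair_iff]
        intro hli
        have := hli 1 (-(k / β + g₃ a x - ν * x)) ?_
        · simp at this
        · rw [sgradK]
          ext i
          fin_cases i <;> simp [sgrad, pt, cross, Sv, Rv, e0, e1, e2, e3, e4, e5, y0, y1, y2, y3, y4, y5]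
          · ring
          · linear_combination ρ * hW
          · ring
          · ring
      · rw [← y2, ← y5]
        rw [← W_val β g₁ g₂ g₃ V a g ν y (by rwa [y5]) hy hg (by rw [y0, y3, y4]; ring)
          (by rw [y1, y3, y4, y5]; ring)]

end
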